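/- Let φ : [0, ∞) → [0, ∞) be convex and increasing with φ(0) = 0, set ψ(t) := e^{φ(t)} − 1, and let φ*(λ) := sup_{t ≥ 0} (λt − φ(t)) be the convex conjugate of φ. Suppose there exists M > 0 such that inf_{λ ≥ 0} (e^{φ*(λ)} − 1)/λ² ≥ M ∫_0^∞ t e^{−φ(t)/2} dt. Then for every real-valued random variable Y with E[Y] = 0 and E[ψ(|Y|)] ≤ 1, and every r > 0, inf_{λ ≥ 0} (r + log E[e^{λY}])/λ ≤ max{3, 3/√(2M)} · φ^{−1}(2r/3), where φ^{−1} denotes the inverse of φ. -/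

import Mathlib

open MeasureTheory
open scoped ENNReal

/-- `Tr μ Y r = inf_{λ ≥ 0} (r + log E[e^{λ Y}])/λ`, with the convention that
`log E[e^{λ Y}] = +∞` when `e^{λ Y}` is not integrable, so that such `λ` (as well as
`λ = 0`, where the expression is `+∞` for `r > 0`) do not contribute to the infimum. -/
noncomputable def Tr {Ω : Type*} [MeasurableSpace Ω] (μ : Measure Ω) (Y : Ω → ℝ) (r : ℝ) : ℝ :=
  sInf {x : ℝ | ∃ l : ℝ, 0 < l ∧ Integrable (fun ω => Real.exp (l * Y ω)) μ ∧
    x = (r + Real.log (∫ ω, Real.exp (l * Y ω) ∂μ)) / l}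

/-- The convex conjugate `φ*(λ) = sup_{t ≥ 0} (λ t - φ(t))`, valued in `[0, ∞]`
(the supremum is nonnegative because `t = 0` gives the value `0`). -/
noncomputable def phistar (φ : ℝ → ℝ) (l : ℝ) : ℝ≥0∞ :=
  ⨆ (t : ℝ) (_ : 0 ≤ t), ENNReal.ofReal (l * t - φ t)

/-- A convex function has a supporting line at every interior point of its domain. -/
lemma ConvexOn.exists_supporting_line {S : Set ℝ} {f : ℝ → ℝ} {x : ℝ} (hf : ConvexOn ℝ S f)
    (hx : x ∈ interior S) : ∃ m : ℝ, ∀ t ∈ S, f x + m * (t - x) ≤ f t := by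
  refine ⟨derivWithin f (Set.Ioi x) x, fun t ht => ?_⟩
  rcases lt_trichotomy t x with h | h | h
  · have h1 := (hf.slope_le_leftDeriv_of_mem_interior ht hx h).trans
      (hf.leftDeriv_le_rightDeriv_of_mem_interior hx)
    rw [slope_def_field, div_le_iff₀ (sub_pos.2 h)] at h1
    linarith
  · simp [h]
  · have h1 := hf.rightDeriv_le_slope_of_mem_interior hx ht h
    rw [slope_def_field, le_div_iff₀ (sub_pos.2 h)] at h1
    linarith

lemma Real.exp_sub_one_le_mul_exp (u : ℝ) : Real.exp u - 1 ≤ u * Real.exp u := by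
  have h1 := mul_le_mul_of_nonneg_right (Real.add_one_le_exp (-u)) (Real.exp_pos u).le
  rw [← Real.exp_add, neg_add_cancel, Real.exp_zero] at h1
  linarith

lemma Real.exp_sub_id_le_exp_abs_sub_abs (x : ℝ) : Real.exp x - x ≤ Real.exp |x| - |x| := by
  rcases le_total 0 x with h | h
  · rw [abs_of_nonneg h]
  · rw [abs_of_nonpos h]
    have h1 := Real.self_le_sinh_iff.2 (neg_nonneg.2 h)
    rw [Real.sinh_eq, neg_neg] at h1
    linarith

lemma Real.exp_sub_one_sub_id_eq_integral (l y : ℝ) :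
    Real.exp (l * y) - 1 - l * y = ∫ t in (0 : ℝ)..y, l * (Real.exp (l * t) - 1) := by
  rw [intervalIntegral.integral_eq_sub_of_hasDerivAt (f := fun t => Real.exp (l * t) - l * t)]
  · simp
    ring
  · intro t _
    have h : HasDerivAt (fun t => l * t) l t := by
      simpa using (hasDerivAt_id t).const_mul l
    exact (h.exp.sub h).congr_deriv (by ring)
  · exact Continuous.intervalIntegrable (by fun_prop) _ _

/-- A function bounded below by an increasing affine function makes `t * exp (-φ t / 2)`
integrable on the half-line. -/
lemma integrableOn_mul_exp_neg_half {φ : ℝ → ℝ} (hmono : MonotoneOn φ (Set.Ici 0)) {m p : ℝ}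
    (hm : 0 < m) (hφ : ∀ t, 0 ≤ t → m * t - p ≤ φ t) :
    IntegrableOn (fun t => t * Real.exp (-φ t / 2)) (Set.Ioi 0) := by
  have hg : IntegrableOn (fun t : ℝ => Real.exp (p / 2) * (t * Real.exp (-(m / 2) * t)))
      (Set.Ioi 0) := by
    have h := integrableOn_rpow_mul_exp_neg_mul_rpow (p := 1) (s := 1) (b := m / 2)
      (by norm_num) one_pos (by positivity)
    simp only [Real.rpow_one] at h
    exact h.const_mul _
  have hmeas : AEMeasurable φ (volume.restrict (Set.Ioi 0)) :=
    aemeasurable_restrict_of_monotoneOn measurableSet_Ioi (hmono.mono Set.Ioi_subset_Ici_self)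
  refine Integrable.mono' hg (aemeasurable_id.mul
    ((hmeas.neg.div_const 2).exp)).aestronglyMeasurable ?_
  filter_upwards [ae_restrict_mem measurableSet_Ioi] with t ht
  have ht0 : (0 : ℝ) < t := ht
  rw [Real.norm_of_nonneg (by positivity), mul_left_comm, ← Real.exp_add]
  gcongr
  linarith [hφ t ht0.le]

/-- Second-order exponential remainder controlled by `exp (φ y)`. -/
lemma exp_sub_one_sub_id_le {φ : ℝ → ℝ} (hmono : MonotoneOn φ (Set.Ici 0)) {m p l : ℝ}
    (hl : 0 < l) (hlm : 2 * l ≤ m) (hφ : ∀ t, 0 ≤ t → m * t - p ≤ φ t) {y : ℝ} (hy : 0 ≤ y) :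
    Real.exp (l * y) - 1 - l * y ≤
      l ^ 2 * Real.exp (p / 2) * (∫ t in Set.Ioi (0 : ℝ), t * Real.exp (-φ t / 2)) *
        Real.exp (φ y) := by
  have hI := integrableOn_mul_exp_neg_half hmono (by linarith : 0 < m) hφ
  rw [Real.exp_sub_one_sub_id_eq_integral, intervalIntegral.integral_of_le hy]
  have hsub : Set.Ioc 0 y ⊆ Set.Ioi (0 : ℝ) := fun t ht => ht.1
  calc ∫ t in Set.Ioc 0 y, l * (Real.exp (l * t) - 1)
      ≤ ∫ t in Set.Ioc 0 y,
          l ^ 2 * Real.exp (p / 2) * Real.exp (φ y) * (t * Real.exp (-φ t / 2)) := by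
        refine setIntegral_mono_on (Continuous.integrableOn_Ioc (by fun_prop))
          ((hI.mono_set hsub).const_mul _) measurableSet_Ioc fun t ht => ?_
        have ht0 : 0 < t := ht.1
        have hty : φ t ≤ φ y := hmono ht0.le hy ht.2
        have hlt : 2 * l * t ≤ m * t := mul_le_mul_of_nonneg_right hlm ht0.le
        have hexp : Real.exp (l * t) ≤
            Real.exp (p / 2) * Real.exp (φ y) * Real.exp (-φ t / 2) := by
          rw [← Real.exp_add, ← Real.exp_add]
          gcongr
          linarith [hφ t ht0.le]
        calc l * (Real.exp (l * t) - 1) ≤ l * (l * t * Real.exp (l * t)) := by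
              gcongr
              exact Real.exp_sub_one_le_mul_exp _
          _ ≤ l * (l * t * (Real.exp (p / 2) * Real.exp (φ y) * Real.exp (-φ t / 2))) := by
              gcongr
          _ = _ := by ring
    _ = l ^ 2 * Real.exp (p / 2) * Real.exp (φ y) *
          ∫ t in Set.Ioc 0 y, t * Real.exp (-φ t / 2) := integral_const_mul _ _
    _ ≤ l ^ 2 * Real.exp (p / 2) * Real.exp (φ y) *
          ∫ t in Set.Ioi 0, t * Real.exp (-φ t / 2) := by
        refine mul_le_mul_of_nonneg_left (setIntegral_mono_set hI ?_ hsub.eventuallyLE)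
          (by positivity)
        filter_upwards [ae_restrict_mem measurableSet_Ioi] with t ht
        have ht0 : (0 : ℝ) < t := ht
        simp only [Pi.zero_apply]
        positivity
    _ = _ := by ring

lemma one_le_integral_exp_mul {Ω : Type*} [MeasurableSpace Ω] {μ : Measure Ω}
    [IsProbabilityMeasure μ] {Y : Ω → ℝ} (hint : Integrable Y μ) (hmean : ∫ ω, Y ω ∂μ = 0)
    {l : ℝ} (hexp : Integrable (fun ω => Real.exp (l * Y ω)) μ) :
    1 ≤ ∫ ω, Real.exp (l * Y ω) ∂μ := by
  have h := integral_mono ((hint.const_mul l).add (integrable_const 1)) hexp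
    (fun ω => Real.add_one_le_exp (l * Y ω))
  simp only [Pi.add_apply] at h
  rw [integral_add (hint.const_mul l) (integrable_const 1), integral_const_mul, hmean] at h
  simpa using h

lemma Tr_le {Ω : Type*} [MeasurableSpace Ω] {μ : Measure Ω}
    [IsProbabilityMeasure μ] {Y : Ω → ℝ} (hint : Integrable Y μ) (hmean : ∫ ω, Y ω ∂μ = 0)
    {r l : ℝ} (hr : 0 ≤ r) (hl : 0 < l) (hexp : Integrable (fun ω => Real.exp (l * Y ω)) μ) :
    Tr μ Y r ≤ (r + Real.log (∫ ω, Real.exp (l * Y ω) ∂μ)) / l := by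
  refine csInf_le ⟨0, ?_⟩ ⟨l, hl, hexp, rfl⟩
  rintro _ ⟨k, hk, hkexp, rfl⟩
  have := Real.log_nonneg (one_le_integral_exp_mul hint hmean hkexp)
  positivity

lemma phistar_le {φ : ℝ → ℝ} {m p : ℝ} (hφ : ∀ t, 0 ≤ t → m * t - p ≤ φ t) :
    phistar φ m ≤ ENNReal.ofReal p :=
  iSup₂_le fun t ht => ENNReal.ofReal_le_ofReal (by linarith [hφ t ht])

/-- for an exponential-type Orlicz function `ψ(t) = e^{φ(t)} - 1`, if for
some `M > 0` one has `(e^{φ*(λ)} - 1)/λ² ≥ M ∫_0^∞ t e^{-φ(t)/2} dt` for all `λ > 0`,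
then every centered `Y` with `E[ψ(|Y|)] ≤ 1` satisfies, for every `r > 0`,
`inf_{λ ≥ 0} (r + log E[e^{λY}])/λ ≤ max{3, 3/√(2M)} · φ⁻¹(2r/3)`. -/
theorem exp_orlicz_coefficient_bound {Ω : Type*} [MeasurableSpace Ω] (μ : Measure Ω)
    [IsProbabilityMeasure μ]
    (φ : ℝ → ℝ) (hconv : ConvexOn ℝ (Set.Ici 0) φ) (hmono : MonotoneOn φ (Set.Ici 0))
    (hφ0 : φ 0 = 0) (hφnn : ∀ t : ℝ, 0 ≤ t → 0 ≤ φ t)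
    (φinv : ℝ → ℝ) (hφinv : ∀ s : ℝ, 0 ≤ s → 0 ≤ φinv s ∧ φ (φinv s) = s)
    (M : ℝ) (hM : 0 < M)
    (hcond : ∀ l : ℝ, 0 < l → phistar φ l ≠ ⊤ →
      M * (∫ t in Set.Ioi (0 : ℝ), t * Real.exp (-φ t / 2)) * l ^ 2 ≤
        Real.exp ((phistar φ l).toReal) - 1)
    (Y : Ω → ℝ) (hY : Measurable Y) (hint : Integrable Y μ) (hmean : ∫ ω, Y ω ∂μ = 0)
    (hψint : Integrable (fun ω => Real.exp (φ |Y ω|) - 1) μ)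
    (hψle : ∫ ω, (Real.exp (φ |Y ω|) - 1) ∂μ ≤ 1)
    (r : ℝ) (hr : 0 < r) :
    Tr μ Y r ≤ max 3 (3 / Real.sqrt (2 * M)) * φinv (2 * r / 3) := by
  obtain ⟨hx0, hφx⟩ := hφinv (2 * r / 3) (by positivity)
  set x := φinv (2 * r / 3)
  have hxpos : 0 < x := by
    refine lt_of_le_of_ne hx0 fun h => ?_
    rw [← h, hφ0] at hφx
    linarith
  obtain ⟨m, hm⟩ := hconv.exists_supporting_line (x := x) (by rw [interior_Ici]; exact hxpos)
  obtain ⟨p, hp⟩ : ∃ p, p = m * x - 2 * r / 3 := ⟨_, rfl⟩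
  have hφm : ∀ t, 0 ≤ t → m * t - p ≤ φ t := fun t ht => by
    have := hm t ht
    rw [hφx] at this
    rw [hp]
    linarith
  have hp0 : 0 ≤ p := by
    have := hφm 0 le_rfl
    rw [hφ0] at this
    linarith
  have hmpos : 0 < m := by
    by_contra! h
    nlinarith [mul_nonneg (neg_nonneg.2 h) hx0]
  have hcond' : M * (∫ t in Set.Ioi (0 : ℝ), t * Real.exp (-φ t / 2)) * m ^ 2 ≤
      Real.exp p - 1 := by
    have hle := phistar_le hφm
    refine (hcond m hmpos (ne_top_of_le_ne_top ENNReal.ofReal_ne_top hle)).trans ?_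
    gcongr
    exact ENNReal.toReal_le_of_le_ofReal hp0 hle
  set C := max 3 (3 / Real.sqrt (2 * M))
  have hC3 : 3 ≤ C := le_max_left _ _
  have hCM : 9 ≤ 2 * M * C ^ 2 := by
    have hs : 0 < Real.sqrt (2 * M) := Real.sqrt_pos.2 (by positivity)
    have h1 : 3 ≤ C * Real.sqrt (2 * M) := (div_le_iff₀ hs).1 (le_max_right _ _)
    have h2 := Real.sq_sqrt (by positivity : 0 ≤ 2 * M)
    calc (9 : ℝ) = 3 ^ 2 := by norm_num
      _ ≤ (C * Real.sqrt (2 * M)) ^ 2 := by gcongr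
      _ = 2 * M * C ^ 2 := by rw [mul_pow, h2]; ring
  have hCpos : 0 < C := by linarith
  obtain ⟨l, hl⟩ : ∃ l, l = 3 * m / (2 * C) := ⟨_, rfl⟩
  have hlpos : 0 < l := by rw [hl]; positivity
  have hlC : 2 * (l * C) = 3 * m := by rw [hl]; field_simp
  have hlm : 2 * l ≤ m := by nlinarith
  set I := ∫ t in Set.Ioi (0 : ℝ), t * Real.exp (-φ t / 2)
  have hI0 : 0 ≤ I := setIntegral_nonneg measurableSet_Ioi fun t ht => by
    have : (0 : ℝ) < t := ht
    positivity
  have hlI : 2 * l ^ 2 * I ≤ Real.exp p - 1 := by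
    refine le_trans ?_ hcond'
    have h1 : 2 * l ^ 2 ≤ M * m ^ 2 := by
      have h2 : m ^ 2 * 9 = 4 * l ^ 2 * C ^ 2 := by linear_combination (-(3 * m + 2 * l * C)) * hlC
      have h3 := mul_le_mul_of_nonneg_left hCM (sq_nonneg m)
      have h4 : 2 * l ^ 2 * C ^ 2 ≤ M * m ^ 2 * C ^ 2 := by linarith
      exact le_of_mul_le_mul_right h4 (by positivity)
    nlinarith
  have hφint : Integrable (fun ω => Real.exp (φ |Y ω|)) μ := by
    refine (hψint.add (integrable_const 1)).congr (ae_of_all _ fun ω => ?_)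
    simp
  have hφle : ∫ ω, Real.exp (φ |Y ω|) ∂μ ≤ 2 := by
    rw [integral_sub hφint (integrable_const 1)] at hψle
    simp at hψle
    linarith
  have hbound : ∀ ω, Real.exp (l * Y ω) ≤
      1 + l * Y ω + l ^ 2 * Real.exp (p / 2) * I * Real.exp (φ |Y ω|) := fun ω => by
    have h1 := exp_sub_one_sub_id_le hmono hlpos hlm hφm (abs_nonneg (Y ω))
    have h2 := Real.exp_sub_id_le_exp_abs_sub_abs (l * Y ω)
    rw [abs_mul, abs_of_pos hlpos] at h2
    linarith
  have hlin : Integrable (fun ω => 1 + l * Y ω) μ := (integrable_const 1).add (hint.const_mul l)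
  have hquad := hφint.const_mul (l ^ 2 * Real.exp (p / 2) * I)
  have hdom : Integrable
      (fun ω => 1 + l * Y ω + l ^ 2 * Real.exp (p / 2) * I * Real.exp (φ |Y ω|)) μ :=
    hlin.add hquad
  have hexp : Integrable (fun ω => Real.exp (l * Y ω)) μ := by
    refine hdom.mono' (hY.const_mul l).exp.aestronglyMeasurable (ae_of_all _ fun ω => ?_)
    rw [Real.norm_of_nonneg (Real.exp_pos _).le]
    exact hbound ω
  have hE : ∫ ω, Real.exp (l * Y ω) ∂μ ≤ Real.exp (3 / 2 * p) := by
    have h1 := integral_mono hexp hdom hbound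
    rw [integral_add hlin hquad, integral_add (integrable_const 1) (hint.const_mul l),
      integral_const_mul, integral_const_mul, hmean] at h1
    have h2 : l ^ 2 * Real.exp (p / 2) * I * ∫ ω, Real.exp (φ |Y ω|) ∂μ ≤
        l ^ 2 * Real.exp (p / 2) * I * 2 := by gcongr
    have h3 := mul_le_mul_of_nonneg_left hlI (Real.exp_pos (p / 2)).le
    have h4 : 1 ≤ Real.exp (p / 2) := Real.one_le_exp (by positivity)
    have h5 : Real.exp (3 / 2 * p) = Real.exp (p / 2) * Real.exp p := by
      rw [← Real.exp_add]
      ring_nf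
    simp only [integral_const, probReal_univ, smul_eq_mul] at h1
    rw [h5]
    linarith
  have hlog : Real.log (∫ ω, Real.exp (l * Y ω) ∂μ) ≤ 3 / 2 * p :=
    (Real.log_le_iff_le_exp
      (one_pos.trans_le (one_le_integral_exp_mul hint hmean hexp))).2 hE
  refine (Tr_le hint hmean hr.le hlpos hexp).trans ?_
  rw [div_le_iff₀ hlpos]
  have h6 : C * x * l = 3 / 2 * (m * x) := by linear_combination (x / 2) * hlC
  linarith
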